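/- Let m(k) = 1/√(1+k²) and define the modulational instability index ind_Bnesq(k) := i₁(k)·i₂⁻(k)·i₂⁺(k)·i_Bnesq(k)/(i₃⁻(k)·i₃⁺(k)). Then ind_Bnesq(k) > 0 for every k > 0. -/

import Mathlib

/-- The regularized Boussinesq dispersion symbol `m(k) = 1/√(1+k²)`. -/
noncomputable def mBnesq (k : ℝ) : ℝ := 1 / Real.sqrt (1 + k^2)

/-- `i₁(k)`, the second derivative of `k ↦ k·m(k)`. -/
noncomputable def i1Bnesq (k : ℝ) : ℝ := deriv (deriv (fun x : ℝ => x * mBnesq x)) k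

/-- `i₂⁻(k) = (k m(k))' − 1`. -/
noncomputable def i2mBnesq (k : ℝ) : ℝ := deriv (fun x : ℝ => x * mBnesq x) k - 1

/-- `i₂⁺(k) = (k m(k))' + 1`. -/
noncomputable def i2pBnesq (k : ℝ) : ℝ := deriv (fun x : ℝ => x * mBnesq x) k + 1

/-- `i₃⁻(k) = m(k) − m(2k)`. -/
noncomputable def i3mBnesq (k : ℝ) : ℝ := mBnesq k - mBnesq (2*k)

/-- `i₃⁺(k) = m(k) + m(2k)`. -/
noncomputable def i3pBnesq (k : ℝ) : ℝ := mBnesq k + mBnesq (2*k)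

/-- `i_Bnesq(k) = 2 i₃⁻(k) i₃⁺(k) + m(2k)² i₂⁻(k) i₂⁺(k)`. -/
noncomputable def iBnesq (k : ℝ) : ℝ :=
  2 * (i3mBnesq k * i3pBnesq k) + (mBnesq (2*k))^2 * (i2mBnesq k * i2pBnesq k)

/-- The modulational instability index for the regularized Boussinesq equation. -/
noncomputable def indBnesq (k : ℝ) : ℝ :=
  i1Bnesq k * i2mBnesq k * i2pBnesq k * iBnesq k / (i3mBnesq k * i3pBnesq k)

theorem mBnesq_pos (x : ℝ) : 0 < mBnesq x := by
  unfold mBnesq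
  positivity

theorem mBnesq_sq (x : ℝ) : mBnesq x ^ 2 = 1 / (1 + x ^ 2) := by
  rw [mBnesq, div_pow, Real.sq_sqrt (by positivity), one_pow]

theorem hasDerivAt_mBnesq (x : ℝ) : HasDerivAt mBnesq (-x * mBnesq x ^ 3) x := by
  have hs : HasDerivAt (fun y : ℝ => 1 + y ^ 2) (2 * x) x := by
    simpa using (hasDerivAt_pow 2 x).const_add 1
  have hpos : 0 < 1 + x ^ 2 := by positivity
  have hinv := (hs.sqrt hpos.ne').fun_inv (Real.sqrt_pos.2 hpos).ne'
  have hm : mBnesq = fun y => (√(1 + y ^ 2))⁻¹ := by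
    funext y
    rw [mBnesq, one_div]
  rw [hm]
  refine hinv.congr_deriv ?_
  have := (Real.sqrt_pos.2 hpos).ne'
  beta_reduce
  field_simp

theorem deriv_id_mul_mBnesq : deriv (fun x : ℝ => x * mBnesq x) = fun x => mBnesq x ^ 3 := by
  funext x
  refine (((hasDerivAt_id' x).fun_mul (hasDerivAt_mBnesq x)).congr_deriv ?_).deriv
  have h : mBnesq x ^ 2 * (1 + x ^ 2) = 1 := by
    rw [mBnesq_sq]
    field_simp
  linear_combination (-mBnesq x) * h

theorem i1Bnesq_eq (k : ℝ) : i1Bnesq k = -3 * k * mBnesq k ^ 5 := by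
  rw [i1Bnesq, deriv_id_mul_mBnesq]
  refine (((hasDerivAt_mBnesq k).fun_pow 3).congr_deriv ?_).deriv
  push_cast
  ring

theorem i2mBnesq_mul_i2pBnesq (k : ℝ) :
    i2mBnesq k * i2pBnesq k = 1 / (1 + k ^ 2) ^ 3 - 1 := by
  have h : (mBnesq k ^ 2) ^ 3 = 1 / (1 + k ^ 2) ^ 3 := by
    rw [mBnesq_sq, div_pow, one_pow]
  rw [i2mBnesq, i2pBnesq, deriv_id_mul_mBnesq]
  linear_combination h

theorem i3mBnesq_mul_i3pBnesq (k : ℝ) :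
    i3mBnesq k * i3pBnesq k = 3 * k ^ 2 / ((1 + k ^ 2) * (1 + 4 * k ^ 2)) := by
  have h : i3mBnesq k * i3pBnesq k = mBnesq k ^ 2 - mBnesq (2 * k) ^ 2 := by
    rw [i3mBnesq, i3pBnesq]
    ring
  rw [h, mBnesq_sq, mBnesq_sq, mul_pow]
  field_simp
  ring

theorem iBnesq_eq (k : ℝ) :
    iBnesq k =
      (3 * k ^ 2 + 9 * k ^ 4 + 5 * k ^ 6) / ((1 + k ^ 2) ^ 3 * (1 + 4 * k ^ 2)) := by
  rw [iBnesq, i3mBnesq_mul_i3pBnesq, i2mBnesq_mul_i2pBnesq, mBnesq_sq, mul_pow]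
  field_simp
  ring

/-- `ind_Bnesq(k) > 0` for every `k > 0`. -/
theorem indBnesq_pos (k : ℝ) (hk : 0 < k) : 0 < indBnesq k := by
  have h1 : i1Bnesq k < 0 := by
    have := mul_pos hk (pow_pos (mBnesq_pos k) 5)
    rw [i1Bnesq_eq]
    linarith
  have h2 : i2mBnesq k * i2pBnesq k < 0 := by
    have : 1 < (1 + k ^ 2) ^ 3 := one_lt_pow₀ (by nlinarith) (by norm_num)
    rw [i2mBnesq_mul_i2pBnesq, sub_neg]
    exact (div_lt_one (by positivity)).2 this
  have h3 : 0 < i3mBnesq k * i3pBnesq k := by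
    rw [i3mBnesq_mul_i3pBnesq]
    positivity
  have h4 : 0 < iBnesq k := by
    rw [iBnesq_eq]
    positivity
  rw [indBnesq, mul_assoc (i1Bnesq k)]
  exact div_pos (mul_pos (mul_pos_of_neg_of_neg h1 h2) h4) h3
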